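/- Let K be a field. In the polynomial ring K[x_1,…,x_{d+1}], the coarse type ideal I, generated by the monomials x^{t(p)} = ∏_{j=1}^{d+1} x_j^{t(p)_j} over all points p ∈ 𝕋^d (where t(p) is the coarse type of p with respect to V), equals the ideal generated by the monomials x_{i_1}^{t_{i_1}} x_{i_2}^{t_{i_2}} ⋯ x_{i_{d'+1}}^{t_{i_{d'+1}}} over all d' ∈ {0,…,d−k+1} and distinct i_1,…,i_{d'+1} ∈ [d+1] such that [d+1]∖{i_1,…,i_{d'}} contains a basis, where t_{i_1} = b_{{i_1},∅} + b_{∅,{i_1,…,i_{d'+1}}} and t_{i_l} = b_{{i_l},{i_1,…,i_{l−1}}} for l = 2,…,d'+1. -/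

import Mathlib

open Finset

noncomputable section

variable {d n : ℕ}

/-- `x ∈ tconv {v i}`, at the level of representatives in `ℝ^{d+1}` modulo constants. -/
def InTconv {ι : Type*} (v : ι → Fin (d + 1) → ℝ) (x : Fin (d + 1) → ℝ) : Prop :=
  ∃ (lam : ι → ℝ) (c : ℝ), ∀ j, x j + c = ⨅ i, (lam i + v i j)

/-- the `k`-th entry of the type of `x` with respect to the generators `v` -/
def typeEntry {ι : Type*} (v : ι → Fin (d + 1) → ℝ) (x : Fin (d + 1) → ℝ)
    (k : Fin (d + 1)) : Set ι :=
  {i | v i k - x k = ⨅ j, (v i j - x j)}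

/-- the spanning subgraph of `G` whose edges are those indexed by `B` -/
def edgeGraph {W : Type*} (G : SimpleGraph W) (ε : Fin (d + 1) ≃ G.edgeSet)
    (B : Finset (Fin (d + 1))) : SimpleGraph W :=
  SimpleGraph.fromEdgeSet {s | ∃ i ∈ B, (ε i : Sym2 W) = s}

/-- `B ⊆ [d+1]` is the edge set of a spanning tree of `G` -/
def IsSpanningTreeEdges {W : Type*} (G : SimpleGraph W) (ε : Fin (d + 1) ≃ G.edgeSet)
    (B : Finset (Fin (d + 1))) : Prop :=
  (edgeGraph G ε B).IsTree

/-- generators of the tropical matroid polytope, in canonical coordinates -/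
def gen (Bs : Fin n → Finset (Fin (d + 1))) (l : Fin n) (i : Fin (d + 1)) : ℝ :=
  if i ∈ Bs l then 0 else 1

/-- data of the cycle matroid of a connected bridgeless simple graph `G` whose `d+1` edges are
enumerated by `ε` and whose bases (spanning-tree edge sets, each of rank/cardinality `k`) are
enumerated without repetition by `Bs`. -/
structure MatroidData (d n k : ℕ) (W : Type) (G : SimpleGraph W)
    (ε : Fin (d + 1) ≃ G.edgeSet) (Bs : Fin n → Finset (Fin (d + 1))) : Prop where
  connected : G.Connected
  bridgeless : ∀ i : Fin (d + 1), ¬ G.IsBridge (ε i : Sym2 W)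
  tree : ∀ l, IsSpanningTreeEdges G ε (Bs l)
  inj : Function.Injective Bs
  all : ∀ B : Finset (Fin (d + 1)), IsSpanningTreeEdges G ε B → ∃ l, Bs l = B
  card : ∀ l, (Bs l).card = k

/-- minimum of `f` over a subset of coordinates (as an infimum) -/
def tmin (I : Set (Fin (d + 1))) (f : Fin (d + 1) → ℝ) : ℝ := sInf (f '' I)

/-- the closed tropical halfspace with apex `p` and type `I` -/
def Halfspace (p : Fin (d + 1) → ℝ) (I : Set (Fin (d + 1))) : Set (Fin (d + 1) → ℝ) :=
  {x | tmin I (fun i => x i - p i) ≤ tmin Iᶜ (fun j => x j - p j)}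

/-- the closed cell of the tropical complex containing `p` -/
def closedCell {ι : Type*} (v : ι → Fin (d + 1) → ℝ) (p : Fin (d + 1) → ℝ) :
    Set (Fin (d + 1) → ℝ) :=
  {x | ∀ k, typeEntry v p k ⊆ typeEntry v x k}

/-- the (closed) cells of the tropical complex `𝒞_V` -/
def IsCell {ι : Type*} (v : ι → Fin (d + 1) → ℝ) (X : Set (Fin (d + 1) → ℝ)) : Prop :=
  ∃ p, X = closedCell v p

/-- the chart `c₀ : 𝕋^d → ℝ^d` -/
def chart (x : Fin (d + 1) → ℝ) (i : Fin d) : ℝ := x i.succ - x 0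

/-- a bounded cell of the tropical complex (bounded as a subset of `𝕋^d ≅ ℝ^d`) -/
def IsBoundedCell {ι : Type*} (v : ι → Fin (d + 1) → ℝ) (X : Set (Fin (d + 1) → ℝ)) : Prop :=
  IsCell v X ∧ Bornology.IsBounded (chart '' X)

/-- an inclusion-maximal bounded cell -/
def IsMaxBoundedCell {ι : Type*} (v : ι → Fin (d + 1) → ℝ) (X : Set (Fin (d + 1) → ℝ)) : Prop :=
  IsBoundedCell v X ∧ ∀ Y, IsBoundedCell v Y → X ⊆ Y → Y = X

/-- an inclusion-maximal cell -/
def IsMaxCell {ι : Type*} (v : ι → Fin (d + 1) → ℝ) (X : Set (Fin (d + 1) → ℝ)) : Prop :=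
  IsCell v X ∧ ∀ Y, IsCell v Y → X ⊆ Y → Y = X

/-- a point of the relative interior of a cell `X`: a point of `X` whose type is
componentwise contained in the type of every point of `X` -/
def IsInteriorPoint {ι : Type*} (v : ι → Fin (d + 1) → ℝ) (X : Set (Fin (d + 1) → ℝ))
    (x : Fin (d + 1) → ℝ) : Prop :=
  x ∈ X ∧ ∀ y ∈ X, ∀ k, typeEntry v x k ⊆ typeEntry v y k

/-- `b_{I,J}`: the number of bases `B` with `I ⊆ B` and `J ∩ B = ∅` -/
def bIJ (Bs : Fin n → Finset (Fin (d + 1))) (I J : Finset (Fin (d + 1))) : ℕ :=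
  (Finset.univ.filter fun l => I ⊆ Bs l ∧ Disjoint J (Bs l)).card

/-- a pseudovertex of the tropical complex: the unique point of `𝕋^d` of its type -/
def IsPseudovertex {ι : Type*} (v : ι → Fin (d + 1) → ℝ) (x : Fin (d + 1) → ℝ) : Prop :=
  ∀ y, (∀ k, typeEntry v y k = typeEntry v x k) → ∃ c : ℝ, y = fun j => x j + c

/-- the pseudovertex `e_{i₁,…,i_s} = -e_J`, `J = [d+1] ∖ {σ 0,…,σ (s-1)}`, in canonical
coordinates: coordinate `1` at `σ 0, …, σ (s-1)` and `0` elsewhere -/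
def ptSeq {r : ℕ} (σ : Fin r → Fin (d + 1)) (s : ℕ) (j : Fin (d + 1)) : ℝ :=
  if ∃ t : Fin r, (t : ℕ) < s ∧ σ t = j then 1 else 0

/-- the generators `-e_I`, `|I| = k`, of the tropical hypersimplex `Δ_k^d`, in
canonical coordinates -/
def genU (d k : ℕ) : {I : Finset (Fin (d + 1)) // I.card = k} → Fin (d + 1) → ℝ :=
  fun I j => if j ∈ I.1 then 0 else 1

/-- The indices `m` for which `σ l` is the first entry of `σ` lying in `Bs m`; those `m` for which
`σ` avoids `Bs m` altogether are counted at `l = 0`. -/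
def firstHit {r : ℕ} (Bs : Fin n → Finset (Fin (d + 1))) (σ : Fin (r + 1) → Fin (d + 1))
    (l : Fin (r + 1)) : Finset (Fin n) :=
  Finset.univ.filter fun m =>
    (σ l ∈ Bs m ∧ ∀ s < l, σ s ∉ Bs m) ∨ (l = 0 ∧ ∀ s, σ s ∉ Bs m)

theorem mem_firstHit {r : ℕ} {Bs : Fin n → Finset (Fin (d + 1))}
    {σ : Fin (r + 1) → Fin (d + 1)} {l : Fin (r + 1)} {m : Fin n} :
    m ∈ firstHit Bs σ l ↔
      (σ l ∈ Bs m ∧ ∀ s < l, σ s ∉ Bs m) ∨ (l = 0 ∧ ∀ s, σ s ∉ Bs m) := by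
  simp [firstHit]

theorem exists_mem_firstHit {r : ℕ} (Bs : Fin n → Finset (Fin (d + 1)))
    (σ : Fin (r + 1) → Fin (d + 1)) (m : Fin n) : ∃ l, m ∈ firstHit Bs σ l := by
  by_cases h : ∃ l, σ l ∈ Bs m
  · obtain ⟨l, hl, hmin⟩ := WellFounded.has_min (wellFounded_lt (α := Fin (r + 1)))
      {l | σ l ∈ Bs m} h
    exact ⟨l, mem_firstHit.2 (Or.inl ⟨hl, fun s hs hmem => hmin s hmem hs⟩)⟩
  · push Not at h
    exact ⟨0, mem_firstHit.2 (Or.inr ⟨rfl, h⟩)⟩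

theorem card_firstHit {r : ℕ} (Bs : Fin n → Finset (Fin (d + 1)))
    (σ : Fin (r + 1) → Fin (d + 1)) (l : Fin (r + 1)) :
    (if l = 0 then bIJ Bs {σ 0} ∅ + bIJ Bs ∅ (Finset.univ.image σ)
      else bIJ Bs {σ l} ((Finset.univ.filter (fun s => s < l)).image σ)) =
      (firstHit Bs σ l).card := by
  split_ifs with h
  · subst h
    rw [bIJ, bIJ, ← Finset.card_union_of_disjoint]
    · congr 1
      ext m
      simp [mem_firstHit, Finset.disjoint_left]
    · rw [Finset.disjoint_filter]
      intro m _ h1 h2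
      exact Finset.disjoint_left.1 h2.2 (Finset.mem_image_of_mem σ (Finset.mem_univ 0))
        (h1.1 (Finset.mem_singleton_self _))
  · rw [bIJ]
    congr 1
    ext m
    simp [mem_firstHit, Finset.disjoint_left, h]

theorem mem_typeEntry_iff {ι : Type*} (v : ι → Fin (d + 1) → ℝ) (x : Fin (d + 1) → ℝ)
    (j : Fin (d + 1)) (i : ι) :
    i ∈ typeEntry v x j ↔ ∀ j', v i j - x j ≤ v i j' - x j' := by
  have hb : BddBelow (Set.range fun j => v i j - x j) := (Set.finite_range _).bddBelow
  constructor
  · intro h j'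
    have h' : v i j - x j = ⨅ j, (v i j - x j) := h
    rw [h']
    exact ciInf_le hb j'
  · intro h
    exact le_antisymm (le_ciInf h) (ciInf_le hb j)

theorem eq_of_mem_typeEntry {ι : Type*} {v : ι → Fin (d + 1) → ℝ} {x : Fin (d + 1) → ℝ}
    {j j' : Fin (d + 1)} {i : ι} (hlt : ∀ a, a ≠ j → v i j - x j < v i a - x a)
    (h : i ∈ typeEntry v x j') : j' = j := by
  by_contra hne
  exact absurd ((mem_typeEntry_iff v x j' i).1 h j) (not_le.2 (hlt j' hne))

theorem exists_edges_isSpanningTree {W : Type*} [Finite W] {G : SimpleGraph W}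
    (hG : G.Connected) (ε : Fin (d + 1) ≃ G.edgeSet) :
    ∃ B : Finset (Fin (d + 1)), IsSpanningTreeEdges G ε B := by
  classical
  obtain ⟨T, hT, hTree⟩ := hG.exists_isTree_le
  refine ⟨Finset.univ.filter fun i => (ε i : Sym2 W) ∈ T.edgeSet, ?_⟩
  have : edgeGraph G ε (Finset.univ.filter fun i => (ε i : Sym2 W) ∈ T.edgeSet) = T := by
    rw [edgeGraph]
    conv_rhs => rw [← SimpleGraph.fromEdgeSet_edgeSet T]
    congr 1
    ext s
    simp only [Finset.mem_filter, Finset.mem_univ, true_and, Set.mem_ofPred_eq]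
    constructor
    · rintro ⟨i, hi, rfl⟩
      exact hi
    · intro hs
      refine ⟨ε.symm ⟨s, SimpleGraph.edgeSet_mono hT hs⟩, ?_, ?_⟩ <;> simp [hs]
  rw [IsSpanningTreeEdges, this]
  exact hTree

/-- A point whose coordinates decrease slowly along `σ` and drop far below elsewhere. -/
def staircase {r : ℕ} (σ : Fin (r + 1) → Fin (d + 1)) : Fin (d + 1) → ℝ :=
  Function.extend σ (fun l => -((l : ℕ) : ℝ) / (r + 1)) (fun _ => -2)

theorem staircase_strict_min {r : ℕ} (Bs : Fin n → Finset (Fin (d + 1)))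
    {σ : Fin (r + 1) → Fin (d + 1)} (hσ : Function.Injective σ) {l : Fin (r + 1)} {m : Fin n}
    (hm : m ∈ firstHit Bs σ l) (a : Fin (d + 1)) (ha : a ≠ σ l) :
    gen Bs m (σ l) - staircase σ (σ l) < gen Bs m a - staircase σ a := by
  have hpos : (0 : ℝ) < r + 1 := by positivity
  have hval : ∀ s, staircase σ (σ s) = -((s : ℕ) : ℝ) / (r + 1) := fun s =>
    hσ.extend_apply _ _ s
  have hgt : ∀ s, -1 < staircase σ (σ s) := fun s => by
    rw [hval, lt_div_iff₀ hpos]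
    have : ((s : ℕ) : ℝ) < r + 1 := by exact_mod_cast s.2
    linarith
  have hanti : ∀ s t, s < t → staircase σ (σ t) < staircase σ (σ s) := fun s t hst => by
    rw [hval, hval]
    have : ((s : ℕ) : ℝ) < (t : ℕ) := by exact_mod_cast hst
    gcongr
  have h0 : staircase σ (σ 0) = 0 := by simp [hval]
  have hle : ∀ s, staircase σ (σ s) ≤ 0 := fun s => by
    rcases eq_or_ne s 0 with rfl | hs
    · exact h0.le
    · rw [← h0]
      exact (hanti 0 s (Fin.pos_iff_ne_zero.2 hs)).le
  have hgen0 : ∀ b, 0 ≤ gen Bs m b := fun b => by unfold gen; split_ifs <;> norm_num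
  have hgen1 : ∀ b, gen Bs m b ≤ 1 := fun b => by unfold gen; split_ifs <;> norm_num
  have hmem : ∀ b, b ∈ Bs m → gen Bs m b = 0 := fun b hb => if_pos hb
  have hnot : ∀ b, b ∉ Bs m → gen Bs m b = 1 := fun b hb => if_neg hb
  by_cases hs : ∃ s, σ s = a
  · obtain ⟨s, rfl⟩ := hs
    have hsl : s ≠ l := fun h => ha (h ▸ rfl)
    rcases mem_firstHit.1 hm with ⟨hl, hlt⟩ | ⟨rfl, hall⟩
    · rw [hmem _ hl]
      rcases lt_or_gt_of_ne hsl with h | h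
      · rw [hnot _ (hlt s h)]
        linarith [hgt l, hle s]
      · linarith [hanti l s h, hgen0 (σ s)]
    · rw [hnot _ (hall 0), hnot _ (hall s)]
      linarith [hanti 0 s (Fin.pos_iff_ne_zero.2 hsl)]
  · have hout : staircase σ a = -2 := Function.extend_apply' _ _ _ hs
    rw [hout]
    rcases mem_firstHit.1 hm with ⟨hl, -⟩ | ⟨rfl, -⟩
    · linarith [hmem _ hl, hgt l, hgen0 a]
    · linarith [hgen1 (σ 0), hgen0 a]

theorem typeEntry_staircase {r : ℕ} (Bs : Fin n → Finset (Fin (d + 1)))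
    {σ : Fin (r + 1) → Fin (d + 1)} (hσ : Function.Injective σ) (l : Fin (r + 1)) :
    typeEntry (gen Bs) (staircase σ) (σ l) = firstHit Bs σ l := by
  ext m
  rw [Finset.mem_coe]
  constructor
  · intro h
    obtain ⟨l', hl'⟩ := exists_mem_firstHit Bs σ m
    rwa [hσ (eq_of_mem_typeEntry (staircase_strict_min Bs hσ hl') h)]
  · intro h
    rw [mem_typeEntry_iff]
    intro a
    rcases eq_or_ne a (σ l) with rfl | ha
    · exact le_rfl
    · exact (staircase_strict_min Bs hσ h a ha).le

theorem typeEntry_staircase_of_notMem {r : ℕ} (Bs : Fin n → Finset (Fin (d + 1)))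
    {σ : Fin (r + 1) → Fin (d + 1)} (hσ : Function.Injective σ) {j : Fin (d + 1)}
    (hj : j ∉ Set.range σ) : typeEntry (gen Bs) (staircase σ) j = ∅ := by
  refine Set.eq_empty_of_forall_notMem fun m hm => hj ?_
  obtain ⟨l, hl⟩ := exists_mem_firstHit Bs σ m
  exact ⟨l, (eq_of_mem_typeEntry (staircase_strict_min Bs hσ hl) hm).symm⟩

theorem length_le_of_forall_notMem {k r : ℕ} {B : Finset (Fin (d + 1))} (hB : B.card = k)
    {σ : Fin (r + 1) → Fin (d + 1)} (hσ : Function.Injective σ)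
    (h : ∀ s : Fin (r + 1), (s : ℕ) < r → σ s ∉ B) : r ≤ d + 1 - k := by
  have hdisj : Disjoint (Finset.univ.image (σ ∘ Fin.castSucc)) B := by
    rw [Finset.disjoint_left]
    intro a ha
    obtain ⟨s, -, rfl⟩ := Finset.mem_image.1 ha
    exact h _ s.2
  have hcard := Finset.card_le_univ (Finset.univ.image (σ ∘ Fin.castSucc) ∪ B)
  rw [Finset.card_union_of_disjoint hdisj, hB,
    Finset.card_image_of_injective _ (hσ.comp (Fin.castSucc_injective r))] at hcard
  simp at hcard
  omega

/-- Every type contains the first-hit type of some admissible sequence. -/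
theorem exists_firstHit_subset_typeEntry (Bs : Fin n → Finset (Fin (d + 1))) (m₀ : Fin n)
    (p : Fin (d + 1) → ℝ) :
    ∃ (r : ℕ) (σ : Fin (r + 1) → Fin (d + 1)), Function.Injective σ ∧
      (∃ m : Fin n, ∀ s : Fin (r + 1), (s : ℕ) < r → σ s ∉ Bs m) ∧
      ∀ l, (firstHit Bs σ l : Set (Fin n)) ⊆ typeEntry (gen Bs) p (σ l) := by
  classical
  obtain ⟨τ, hτ⟩ : ∃ τ : Equiv.Perm (Fin (d + 1)), Antitone (p ∘ τ) :=
    ⟨Tuple.sort fun j => -p j, fun a b hab => by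
      have := Tuple.monotone_sort (fun j => -p j) hab
      simpa using this⟩
  let Good : ℕ → Prop := fun r => ∃ hr : r < d + 1, p (τ 0) - 1 < p (τ ⟨r, hr⟩) ∧
    ∃ m : Fin n, ∀ s : Fin (d + 1), (s : ℕ) < r → τ s ∉ Bs m
  have hgood0 : Good 0 := ⟨Nat.succ_pos d, by simp, m₀, fun s hs => absurd hs (Nat.not_lt_zero _)⟩
  obtain ⟨r, hgood, hnext⟩ : ∃ r, Good r ∧ ¬ Good (r + 1) := by
    by_contra! h
    have hall : ∀ r, Good r := fun r => Nat.rec hgood0 (fun r hr => h r hr) r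
    exact absurd (hall (d + 1)).1 (lt_irrefl _)
  obtain ⟨hr, hpr, m₁, hm₁⟩ := hgood
  have hmax : ∀ j, p j ≤ p (τ 0) := fun j => by
    simpa using hτ (Fin.zero_le (τ.symm j))
  refine ⟨r, fun s => τ (Fin.castLE hr s),
    τ.injective.comp (Fin.castLE_injective hr), ⟨m₁, fun s hs => hm₁ _ hs⟩, ?_⟩
  intro l m hm
  rw [mem_typeEntry_iff]
  intro j
  rcases mem_firstHit.1 (Finset.mem_coe.1 hm) with ⟨hl, hlt⟩ | ⟨rfl, hall⟩
  · have hpl : p (τ 0) - 1 < p (τ (Fin.castLE hr l)) :=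
      hpr.trans_le (hτ (show Fin.castLE hr l ≤ ⟨r, hr⟩ from Nat.lt_succ_iff.1 l.2))
    by_cases hj : j ∈ Bs m
    · have hle : Fin.castLE hr l ≤ τ.symm j := by
        by_contra! h
        have h' : (τ.symm j : ℕ) < l := h
        refine hlt ⟨τ.symm j, h'.trans l.2⟩ h' ?_
        have : Fin.castLE hr ⟨τ.symm j, h'.trans l.2⟩ = τ.symm j := rfl
        simpa [this] using hj
      have := hτ hle
      simp only [Function.comp_apply, Equiv.apply_symm_apply] at this
      simp only [gen, if_pos hl, if_pos hj]
      linarith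
    · simp only [gen, if_pos hl, if_neg hj]
      linarith [hmax j]
  · have h0 : τ 0 ∉ Bs m := hall 0
    change gen Bs m (τ 0) - p (τ 0) ≤ gen Bs m j - p j
    by_cases hj : j ∈ Bs m
    · have hle : r + 1 ≤ (τ.symm j : ℕ) := by
        by_contra! h
        refine hall ⟨τ.symm j, h⟩ ?_
        have : Fin.castLE hr ⟨τ.symm j, h⟩ = τ.symm j := rfl
        simpa [this] using hj
      have hr' : r + 1 < d + 1 := hle.trans_lt (τ.symm j).2
      have hdrop : p (τ ⟨r + 1, hr'⟩) ≤ p (τ 0) - 1 := by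
        by_contra! h
        exact hnext ⟨hr', h, m, fun s hs => hall ⟨s, hs⟩⟩
      have := hτ (show (⟨r + 1, hr'⟩ : Fin (d + 1)) ≤ τ.symm j from hle)
      simp only [Function.comp_apply, Equiv.apply_symm_apply] at this
      simp only [gen, if_neg h0, if_pos hj]
      linarith
    · simp only [gen, if_neg h0, if_neg hj]
      linarith [hmax j]

/-- The coarse type ideal of the tropical complex of a tropical matroid
polytope with `d+1` elements and rank `k` — the ideal generated by the monomials `x^{t(p)}`
over all points `p ∈ 𝕋^d` — equals the ideal generated by the monomials
`x_{i₁}^{t_{i₁}} ⋯ x_{i_{d'+1}}^{t_{i_{d'+1}}}` over all `d' ≤ d+1-k` and distinct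
`i₁, …, i_{d'+1}` such that `[d+1] ∖ {i₁,…,i_{d'}}` contains a basis, where
`t_{i₁} = b_{{i₁},∅} + b_{∅,{i₁,…,i_{d'+1}}}` and `t_{i_l} = b_{{i_l},{i₁,…,i_{l-1}}}`. -/
theorem coarseTypeIdeal_tropicalMatroidPolytope
    (K : Type) [Field K]
    (d n k : ℕ) (W : Type) [Fintype W] (G : SimpleGraph W)
    (ε : Fin (d + 1) ≃ G.edgeSet) (Bs : Fin n → Finset (Fin (d + 1)))
    (hM : MatroidData d n k W G ε Bs) :
    Ideal.span {q : MvPolynomial (Fin (d + 1)) K |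
        ∃ p : Fin (d + 1) → ℝ,
          q = ∏ j : Fin (d + 1), MvPolynomial.X j ^ (typeEntry (gen Bs) p j).ncard} =
      Ideal.span {q : MvPolynomial (Fin (d + 1)) K |
        ∃ d' : ℕ, d' ≤ d + 1 - k ∧
          ∃ σ : Fin (d' + 1) → Fin (d + 1), Function.Injective σ ∧
            (∃ m : Fin n, ∀ s : Fin (d' + 1), (s : ℕ) < d' → σ s ∉ Bs m) ∧
            q = ∏ l : Fin (d' + 1),
              MvPolynomial.X (σ l) ^
                (if l = 0 then bIJ Bs {σ 0} ∅ + bIJ Bs ∅ (Finset.univ.image σ)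
                 else bIJ Bs {σ l} ((Finset.univ.filter (fun s => s < l)).image σ))} := by
  simp only [card_firstHit]
  apply le_antisymm
  · rw [Ideal.span_le]
    rintro q ⟨p, rfl⟩
    obtain ⟨B, hB⟩ := exists_edges_isSpanningTree hM.connected ε
    obtain ⟨m₀, -⟩ := hM.all B hB
    obtain ⟨r, σ, hσ, ⟨m, hm⟩, hsub⟩ := exists_firstHit_subset_typeEntry Bs m₀ p
    refine Ideal.mem_of_dvd _ ?_ (Ideal.subset_span
      ⟨r, length_le_of_forall_notMem (hM.card m) hσ hm, σ, hσ, ⟨m, hm⟩, rfl⟩)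
    calc ∏ l, MvPolynomial.X (σ l) ^ (firstHit Bs σ l).card
        ∣ ∏ l, (MvPolynomial.X (σ l) : MvPolynomial (Fin (d + 1)) K) ^
            (typeEntry (gen Bs) p (σ l)).ncard :=
          Finset.prod_dvd_prod_of_dvd _ _ fun l _ => pow_dvd_pow _ <| by
            rw [← Set.ncard_coe_finset]
            exact Set.ncard_le_ncard (hsub l) (Set.toFinite _)
      _ = ∏ j ∈ Finset.univ.image σ, MvPolynomial.X j ^ (typeEntry (gen Bs) p j).ncard :=
          (Finset.prod_image (f := fun j => (MvPolynomial.X j : MvPolynomial (Fin (d + 1)) K) ^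
            (typeEntry (gen Bs) p j).ncard) hσ.injOn).symm
      _ ∣ ∏ j, MvPolynomial.X j ^ (typeEntry (gen Bs) p j).ncard :=
          Finset.prod_dvd_prod_of_subset _ _ _ (Finset.subset_univ _)
  · rw [Ideal.span_le]
    rintro q ⟨r, -, σ, hσ, -, rfl⟩
    refine Ideal.subset_span ⟨staircase σ, Fintype.prod_of_injective σ hσ _ _ ?_ ?_⟩
    · intro j hj
      simp [typeEntry_staircase_of_notMem Bs hσ hj]
    · intro l
      rw [typeEntry_staircase Bs hσ, Set.ncard_coe_finset]
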